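/- Let n ≥ 3 be an odd integer with 3 ∤ n. Then in the dicyclic group Dic_{4n}: the number of MSTD subsets of cardinality 3 is S_{Dic_{4n}}(3) = 4n(n−1)(2n−5), the number of MDTS subsets of cardinality 3 is D_{Dic_{4n}}(3) = 2n(n−1)(2n+5)/3, and the number of balanced subsets of cardinality 3 is B_{Dic_{4n}}(3) = 2n(2n²+27n−23)/3. -/

import Mathlib

open Finset Pointwise

/-- A finset of a group is MSTD if its sumset `A * A` is larger than its
difference set `A / A = {a₁ * a₂⁻¹}`. -/
def IsMSTD {G : Type*} [Group G] [DecidableEq G] (A : Finset G) : Prop :=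
  (A / A).card < (A * A).card

/-- A finset of a group is MDTS if its sumset is smaller than its difference set. -/
def IsMDTS {G : Type*} [Group G] [DecidableEq G] (A : Finset G) : Prop :=
  (A * A).card < (A / A).card

/-- A finset of a group is balanced if its sumset and difference set have equal size. -/
def IsBalanced {G : Type*} [Group G] [DecidableEq G] (A : Finset G) : Prop :=
  (A * A).card = (A / A).card

theorem six_mul_ncard_card_eq_three {α : Type*} [Fintype α] [DecidableEq α]
    (P : Finset α → Prop) [DecidablePred P] :
    6 * {A : Finset α | A.card = 3 ∧ P A}.ncard =
      ∑ x, ∑ y, ∑ z, if (x ≠ y ∧ x ≠ z ∧ y ≠ z) ∧ P {x, y, z} then 1 else 0 := by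
  set S : Finset (Finset α) := {A | A.card = 3 ∧ P A} with hS
  set T : Finset (α × α × α) :=
    {t | (t.1 ≠ t.2.1 ∧ t.1 ≠ t.2.2 ∧ t.2.1 ≠ t.2.2) ∧ P {t.1, t.2.1, t.2.2}} with hT
  have h_set : {A : Finset α | A.card = 3 ∧ P A} = (S : Set (Finset α)) := by
    ext A; simp [hS]
  have h_sum : (∑ x, ∑ y, ∑ z, if (x ≠ y ∧ x ≠ z ∧ y ≠ z) ∧ P {x, y, z} then 1 else 0) =
      T.card := by
    rw [hT, Finset.card_filter, Fintype.sum_prod_type]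
    simp_rw [Fintype.sum_prod_type]
  rw [h_set, Set.ncard_coe_finset, h_sum,
    Finset.card_eq_sum_card_fiberwise (f := fun t : α × α × α => ({t.1, t.2.1, t.2.2} : Finset α))
      (t := S)]
  · rw [Finset.sum_const_nat (m := 6), mul_comm]
    intro A hA
    obtain ⟨hA3, hPA⟩ := (Finset.mem_filter.mp hA).2
    obtain ⟨x, y, z, hxy, hxz, hyz, rfl⟩ := Finset.card_eq_three.mp hA3
    have h_fiber : T.filter (fun t => ({t.1, t.2.1, t.2.2} : Finset α) = {x, y, z}) =
        {(x, y, z), (x, z, y), (y, x, z), (y, z, x), (z, x, y), (z, y, x)} := by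
      ext ⟨p, q, r⟩
      simp only [hT, Finset.mem_filter, Finset.mem_univ, true_and, Finset.mem_insert,
        Finset.mem_singleton, Prod.mk.injEq]
      constructor
      · rintro ⟨⟨⟨h1, h2, h3⟩, -⟩, h⟩
        have hp : p ∈ ({x, y, z} : Finset α) := h ▸ by simp
        have hq : q ∈ ({x, y, z} : Finset α) := h ▸ by simp
        have hr : r ∈ ({x, y, z} : Finset α) := h ▸ by simp
        simp only [Finset.mem_insert, Finset.mem_singleton] at hp hq hr
        grind
      · intro h
        have h_eq : ({p, q, r} : Finset α) = {x, y, z} := by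
          ext w
          simp only [Finset.mem_insert, Finset.mem_singleton]
          grind
        refine ⟨⟨?_, h_eq ▸ hPA⟩, h_eq⟩
        grind
    rw [h_fiber]
    simp [Finset.card_insert_of_notMem, hxy, hxz, hyz, hxy.symm, hxz.symm, hyz.symm]
  · rintro ⟨x, y, z⟩ ht
    obtain ⟨⟨hxy, hxz, hyz⟩, hP⟩ := (Finset.mem_filter.mp (Finset.mem_coe.mp ht)).2
    exact Finset.mem_coe.mpr (Finset.mem_filter.mpr ⟨Finset.mem_univ _,
      Finset.card_eq_three.mpr ⟨x, y, z, hxy, hxz, hyz, rfl⟩, hP⟩)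

theorem sum_ite_eq_of_iff_notMem {α : Type*} [Fintype α] [DecidableEq α] (T : Finset α)
    (p : α → Prop) [DecidablePred p] (h : ∀ x, p x ↔ x ∉ T) {c : ℕ} :
    (∑ x, if p x then c else 0) = (Fintype.card α - T.card) * c := by
  rw [← Finset.sum_filter, Finset.sum_const, smul_eq_mul, ← Finset.card_compl]
  congr 2
  ext
  simp [h]

theorem sum_ite_eq_of_iff_mem {α : Type*} [Fintype α] [DecidableEq α] (T : Finset α)
    (p : α → Prop) [DecidablePred p] (h : ∀ x, p x ↔ x ∈ T) {c : ℕ} :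
    (∑ x, if p x then c else 0) = T.card * c := by
  rw [← Finset.sum_filter, Finset.sum_const, smul_eq_mul]
  congr 2
  ext
  simp [h]

theorem sum_ite_pairwise_ne {α : Type*} [Fintype α] [DecidableEq α] :
    (∑ i : α, ∑ j : α, ∑ k : α, if i ≠ j ∧ i ≠ k ∧ j ≠ k then 1 else 0) =
      Fintype.card α * ((Fintype.card α - 1) * (Fintype.card α - 2)) := by
  have hj (i : α) : (∑ j : α, ∑ k : α, if i ≠ j ∧ i ≠ k ∧ j ≠ k then 1 else 0) =
      (Fintype.card α - 1) * (Fintype.card α - 2) := by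
    have hc := sum_ite_eq_of_iff_notMem (c := Fintype.card α - 2) {i} (· ≠ i) (by simp)
    rw [Finset.card_singleton] at hc
    rw [← hc]
    refine Finset.sum_congr rfl fun j _ => ?_
    split_ifs with hij
    · rw [sum_ite_eq_of_iff_notMem {i, j} (fun k : α => i ≠ j ∧ i ≠ k ∧ j ≠ k),
        Finset.card_pair hij.symm, mul_one]
      intro k
      simp only [Finset.mem_insert, Finset.mem_singleton, ne_eq, eq_comm (b := k),
        eq_comm (a := i) (b := j), hij]
      tauto
    · simp [not_not.mp hij]
  simp_rw [hj]
  rw [Finset.sum_const, Finset.card_univ, smul_eq_mul]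

section LoneInvolution

variable {R : Type*} [CommRing R] {h : R}

/-- `h` is the unique involution of the additive group of `R`, and it is not divisible by two. -/
structure IsLoneInvolution (h : R) : Prop where
  add_self : h + h = 0
  ne_zero : h ≠ 0
  eq_or_eq : ∀ x : R, x + x = 0 → x = 0 ∨ x = h
  add_self_ne : ∀ x : R, x + x ≠ h

namespace IsLoneInvolution

theorem add_self_eq_add_self_iff (H : IsLoneInvolution h) {x y : R} (hxy : x ≠ y) :
    x + x = y + y ↔ y = x + h := by
  constructor
  · intro e
    rcases H.eq_or_eq (y - x) (by linear_combination -e) with e' | e'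
    · exact absurd (by linear_combination -e') hxy
    · linear_combination e'
  · rintro rfl
    linear_combination -H.add_self

theorem add_self_eq_zero_of_four (H : IsLoneInvolution h) {x : R} (hx : x + x + (x + x) = 0) :
    x + x = 0 :=
  (H.eq_or_eq _ hx).resolve_right (H.add_self_ne x)

variable [DecidableEq R]

theorem compare_a_a_xa (H : IsLoneInvolution h) {i j : R} (k : R) (hij : i ≠ j) :
    (({0, i - j, j - i} : Finset R).card + ({k - i, k - j, h + k - i, h + k - j} : Finset R).card <
      ({i + i, j + j, i + j, h} : Finset R).card + ({k + i, k - i, k + j, k - j} : Finset R).card ↔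
      i + i ≠ 0 ∧ j + j ≠ 0 ∧ i + j ≠ 0 ∧ i + j ≠ h) ∧
    (({i + i, j + j, i + j, h} : Finset R).card + ({k + i, k - i, k + j, k - j} : Finset R).card <
      ({0, i - j, j - i} : Finset R).card + ({k - i, k - j, h + k - i, h + k - j} : Finset R).card ↔
      i + j = 0) := by
  have hh := H.add_self
  have hP := H.add_self_eq_add_self_iff hij
  have hQ : j = i + h → i + j ≠ 0 := fun p e => H.add_self_ne i (by linear_combination e - p - hh)
  have hRU : j = i + h → i + j = h → i + i = 0 := fun p e => by linear_combination e - p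
  have hUR : j = i + h → i + i = 0 → i + j = h := fun p e => by linear_combination e + p
  have hUV : i + i = 0 → j + j = 0 → j = i + h := fun e e' => hP.mp (e.trans e'.symm)
  have hPV : j = i + h → (j + j = 0 ↔ i + i = 0) := fun p => by rw [hP.mpr p]
  have hQV : i + j = 0 → (j + j = 0 ↔ i + i = 0) := fun q => by
    constructor <;> intro e <;> linear_combination 2 * q - e
  have hRV : i + j = h → (j + j = 0 ↔ i + i = 0) := fun q => by
    constructor <;> intro e <;> linear_combination 2 * q - e + hh
  have hRQ : i + j = h → i + j ≠ 0 := fun r q => H.ne_zero (r.symm.trans q)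
  have e₁ : 0 = i - j ↔ False := by simpa [eq_comm, sub_eq_zero] using hij
  have e₂ : 0 = j - i ↔ False := by simpa [eq_comm, sub_eq_zero] using hij.symm
  have e₃ : i - j = j - i ↔ j = i + h := by
    rw [← hP]; constructor <;> intro e <;> linear_combination e
  have e₄ : k + i = k - i ↔ i + i = 0 := by
    constructor <;> intro e <;> linear_combination e
  have e₅ : k + j = k - j ↔ j + j = 0 := by
    constructor <;> intro e <;> linear_combination e
  have e₆ : k + i = k - j ↔ i + j = 0 := by
    constructor <;> intro e <;> linear_combination e
  have e₇ : k - i = k + j ↔ i + j = 0 := by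
    constructor <;> intro e <;> linear_combination -e
  have e₈ : k - i = h + k - j ↔ j = i + h := by
    constructor <;> intro e <;> linear_combination e
  have e₉ : k - j = h + k - i ↔ j = i + h := by
    constructor <;> intro e <;> linear_combination -e - hh
  have e₁₀ : k - i = h + k - i ↔ False := by simp [add_sub_assoc, H.ne_zero]
  have e₁₁ : k - j = h + k - j ↔ False := by simp [add_sub_assoc, H.ne_zero]
  have e₁₂ : k - i = k - j ↔ False := by simpa using hij
  have e₁₃ : h + k - i = h + k - j ↔ False := by simpa using hij
  have e₁₄ : j + j = i + j ↔ False := by simpa using hij.symm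
  simp only [Finset.card_insert_eq_ite, Finset.card_singleton, Finset.mem_insert,
    Finset.mem_singleton, hP, add_right_inj, H.add_self_ne, hij, e₁, e₂, e₃, e₄, e₅, e₆, e₇, e₈,
    e₉, e₁₀, e₁₁, e₁₂, e₁₃, e₁₄, ne_eq]
  clear hh hP e₁ e₂ e₃ e₄ e₅ e₆ e₇ e₈ e₉ e₁₀ e₁₁ e₁₂ e₁₃ e₁₄
  grind -ring -linarith

theorem compare_a_xa_xa (H : IsLoneInvolution h) (i : R) {j k : R} (hjk : j ≠ k) :
    (({0, j - k, k - j} : Finset R).card + ({j - i, k - i, h + j - i, h + k - i} : Finset R).card <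
      ({i + i, h, h + j - k, h + k - j} : Finset R).card +
        ({j + i, j - i, k + i, k - i} : Finset R).card ↔
      i + i ≠ 0 ∧ k ≠ j + i + i ∧ k ≠ j - i - i ∧ k ≠ h + j + i + i ∧ k ≠ h + j - i - i) ∧
    (({i + i, h, h + j - k, h + k - j} : Finset R).card +
        ({j + i, j - i, k + i, k - i} : Finset R).card <
      ({0, j - k, k - j} : Finset R).card + ({j - i, k - i, h + j - i, h + k - i} : Finset R).card ↔
      i + i = 0 ∧ k ≠ h + j) := by
  have hh := H.add_self
  have hP := H.add_self_eq_add_self_iff hjk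
  have h_four : i + i + (i + i) = 0 → i + i = 0 := H.add_self_eq_zero_of_four
  have h_four' := H.add_self_ne (i + i)
  have h₁ : i + i = 0 → (k = j + i + i ↔ k = j) := fun u => by
    rw [add_assoc, u, add_zero]
  have h₂ : i + i = 0 → (k = j - i - i ↔ k = j) := fun u => by
    rw [sub_sub, u, sub_zero]
  have h₃ : i + i = 0 → (k = h + j + i + i ↔ k = j + h) := fun u => by
    rw [add_assoc _ i i, u, add_zero, add_comm h]
  have h₄ : i + i = 0 → (k = h + j - i - i ↔ k = j + h) := fun u => by
    rw [sub_sub, u, sub_zero, add_comm h]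
  have h₅ : k = j + h → k ≠ j + i + i := fun p e => H.add_self_ne i (by linear_combination p - e)
  have h₆ : k = j + h → k ≠ j - i - i := fun p e =>
    H.add_self_ne i (by linear_combination e - p - hh)
  have h₇ : k = j + h → k = h + j + i + i → i + i = 0 := fun p e => by linear_combination p - e
  have h₈ : k = j + h → k = h + j - i - i → i + i = 0 := fun p e => by linear_combination e - p
  have h₉ : k = j + i + i → k = j - i - i → i + i = 0 := fun p e => h_four (by
    linear_combination e - p)
  have h₁₀ : k = j + i + i → k ≠ h + j + i + i := fun p e => H.ne_zero (by
    linear_combination p - e)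
  have h₁₁ : k = j + i + i → k ≠ h + j - i - i := fun p e => h_four' (by
    linear_combination e - p)
  have h₁₂ : k = j - i - i → k ≠ h + j + i + i := fun p e => h_four' (by
    linear_combination p - e - hh)
  have h₁₃ : k = j - i - i → k ≠ h + j - i - i := fun p e => H.ne_zero (by
    linear_combination p - e)
  have h₁₄ : k = h + j + i + i → k = h + j - i - i → i + i = 0 := fun p e => h_four (by
    linear_combination e - p)
  have e₁ : i + i = h + j - k ↔ k = h + j - i - i := by
    constructor <;> intro e <;> linear_combination e
  have e₂ : i + i = h + k - j ↔ k = h + j + i + i := by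
    constructor <;> intro e <;> linear_combination -hh - e
  have e₃ : h = h + j - k ↔ False := by simpa [add_sub_assoc, sub_eq_zero] using hjk
  have e₄ : h = h + k - j ↔ False := by simpa [add_sub_assoc, sub_eq_zero] using hjk.symm
  have e₅ : h + j - k = h + k - j ↔ k = j + h := by
    rw [← hP]; constructor <;> intro e <;> linear_combination e
  have e₆ : j + i = j - i ↔ i + i = 0 := by
    constructor <;> intro e <;> linear_combination e
  have e₇ : j + i = k - i ↔ k = j + i + i := by
    constructor <;> intro e <;> linear_combination -e
  have e₈ : j - i = k + i ↔ k = j - i - i := by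
    constructor <;> intro e <;> linear_combination -e
  have e₉ : k + i = k - i ↔ i + i = 0 := by
    constructor <;> intro e <;> linear_combination e
  have e₁₀ : 0 = j - k ↔ False := by simpa [eq_comm, sub_eq_zero] using hjk
  have e₁₁ : 0 = k - j ↔ False := by simpa [eq_comm, sub_eq_zero] using hjk.symm
  have e₁₂ : j - k = k - j ↔ k = j + h := by
    rw [← hP]; constructor <;> intro e <;> linear_combination e
  have e₁₃ : j - i = h + k - i ↔ k = j + h := by
    constructor <;> intro e <;> linear_combination -e - hh
  have e₁₄ : k - i = h + j - i ↔ k = j + h := by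
    constructor <;> intro e <;> linear_combination e
  have e₁₅ : j - i = h + j - i ↔ False := by simp [add_sub_assoc, H.ne_zero]
  have e₁₆ : k - i = h + k - i ↔ False := by simp [add_sub_assoc, H.ne_zero]
  have e₁₇ : k = h + j ↔ k = j + h := by rw [add_comm]
  simp only [Finset.card_insert_eq_ite, Finset.card_singleton, Finset.mem_insert,
    Finset.mem_singleton, H.add_self_ne, add_left_inj, sub_left_inj, add_right_inj, hjk, e₁, e₂, e₃,
    e₄, e₅, e₆, e₇, e₈, e₉, e₁₀, e₁₁, e₁₂, e₁₃, e₁₄, e₁₅, e₁₆, e₁₇, ne_eq]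
  clear hh hP h_four h_four' e₁ e₂ e₃ e₄ e₅ e₆ e₇ e₈ e₉ e₁₀ e₁₁ e₁₂ e₁₃ e₁₄ e₁₅ e₁₆ e₁₇
  have hkj := hjk.symm
  grind -ring -linarith

theorem card_sum_lt_card_diff (H : IsLoneInvolution h) {i j k : R} (hij : i ≠ j)
    (hik : i ≠ k) (hjk : j ≠ k) (h₁ : j + k ≠ i + i) (h₂ : i + k ≠ j + j) (h₃ : i + j ≠ k + k) :
    ({i + i, j + j, k + k, i + j, i + k, j + k} : Finset R).card <
      ({0, i - j, j - i, i - k, k - i, j - k, k - j} : Finset R).card := by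
  have hUV : i + i = j + j → i + i ≠ k + k := fun u v => hjk (by
    rw [(H.add_self_eq_add_self_iff hij).mp u, (H.add_self_eq_add_self_iff hik).mp v])
  have hUW : i + i = j + j → j + j ≠ k + k := fun u w => hUV u (u.trans w)
  have hVW : i + i = k + k → j + j ≠ k + k := fun v w => hUV (v.trans w.symm) v
  have hσ : ({i + i, j + j, k + k, i + j, i + k, j + k} : Finset R).card ≤
      if i + i = j + j ∨ i + i = k + k ∨ j + j = k + k then 5 else 6 := by
    split_ifs with hc
    · rcases hc with hc | hc | hc <;> rw [hc]
      · rw [Finset.insert_eq_of_mem (by simp)]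
        exact Finset.card_le_five
      · rw [Finset.insert_eq_of_mem (by simp)]
        exact Finset.card_le_five
      · rw [Finset.insert_eq_of_mem (a := k + k) (by simp)]
        exact Finset.card_le_five
    · exact Finset.card_le_six
  refine hσ.trans_lt ?_
  have e₁ : i - j = j - i ↔ i + i = j + j := by
    constructor <;> intro e <;> linear_combination e
  have e₂ : i - k = k - i ↔ i + i = k + k := by
    constructor <;> intro e <;> linear_combination e
  have e₃ : j - k = k - j ↔ j + j = k + k := by
    constructor <;> intro e <;> linear_combination e
  have e₄ : i - j = k - i ↔ False := by
    simpa using fun e => h₁ (by linear_combination -e)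
  have e₅ : j - i = i - k ↔ False := by
    simpa using fun e => h₁ (by linear_combination e)
  have e₆ : i - j = j - k ↔ False := by
    simpa using fun e => h₂ (by linear_combination e)
  have e₇ : j - i = k - j ↔ False := by
    simpa using fun e => h₂ (by linear_combination -e)
  have e₈ : i - k = k - j ↔ False := by
    simpa using fun e => h₃ (by linear_combination e)
  have e₉ : k - i = j - k ↔ False := by
    simpa using fun e => h₃ (by linear_combination -e)
  have z : ∀ {x y : R}, x ≠ y → (0 = x - y ↔ False) := fun {x y} hxy => by
    simpa [eq_comm, sub_eq_zero] using hxy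
  simp only [Finset.card_insert_eq_ite, Finset.card_singleton, Finset.mem_insert,
    Finset.mem_singleton, sub_right_inj, sub_left_inj, hij, hik, hjk, z hij,
    z hik, z hjk, z hij.symm, z hik.symm, z hjk.symm, e₁, e₂, e₃, e₄, e₅, e₆, e₇, e₈, e₉]
  clear z e₁ e₂ e₃ e₄ e₅ e₆ e₇ e₈ e₉ hσ
  grind -ring -linarith

theorem card_sum_eq_card_diff (i j k : R) (hk : j + k = i + i) :
    ({i + i, j + j, k + k, i + j, i + k, j + k} : Finset R).card =
      ({0, i - j, j - i, i - k, k - i, j - k, k - j} : Finset R).card := by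
  rw [← Finset.card_image_of_injective
    ({0, i - j, j - i, i - k, k - i, j - k, k - j} : Finset R) (add_left_injective (i + i))]
  obtain rfl : k = i + i - j := by linear_combination hk
  congr 1
  ext r
  simp only [Finset.mem_image, Finset.mem_insert, Finset.mem_singleton, exists_eq_or_imp,
    exists_eq_left]
  grind

variable [Fintype R]

theorem sum_ite_add_self_ne_zero (H : IsLoneInvolution h) (c : ℕ) :
    (∑ i : R, if i + i ≠ 0 then c else 0) = (Fintype.card R - 2) * c := by
  rw [sum_ite_eq_of_iff_notMem {0, h} (fun i : R => i + i ≠ 0), Finset.card_pair H.ne_zero.symm]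
  intro x
  simp only [Finset.mem_insert, Finset.mem_singleton, ne_eq, not_iff_not]
  refine ⟨H.eq_or_eq x, ?_⟩
  rintro (rfl | rfl)
  exacts [add_zero 0, H.add_self]

theorem sum_ite_add_self_eq_zero (H : IsLoneInvolution h) (c : ℕ) :
    (∑ i : R, if i + i = 0 then c else 0) = 2 * c := by
  rw [sum_ite_eq_of_iff_mem {0, h} (fun i : R => i + i = 0), Finset.card_pair H.ne_zero.symm]
  intro x
  simp only [Finset.mem_insert, Finset.mem_singleton]
  refine ⟨H.eq_or_eq x, ?_⟩
  rintro (rfl | rfl)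
  exacts [add_zero 0, H.add_self]

theorem count_mstd_a_a_xa (H : IsLoneInvolution h) :
    (∑ i : R, ∑ j : R, ∑ _k : R,
      if i ≠ j ∧ i + i ≠ 0 ∧ j + j ≠ 0 ∧ i + j ≠ 0 ∧ i + j ≠ h then 1 else 0) =
      (Fintype.card R - 2) * ((Fintype.card R - 5) * Fintype.card R) := by
  rw [← H.sum_ite_add_self_ne_zero]
  refine Finset.sum_congr rfl fun i _ => ?_
  split_ifs with hi
  · rw [Finset.sum_comm]
    have hT : ({i, -i, h - i, 0, h} : Finset R).card = 5 := by
      have e₁ : i ≠ -i := fun e => hi (by linear_combination e)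
      have e₂ : i ≠ h - i := fun e => H.add_self_ne i (by linear_combination e)
      have e₃ : i ≠ 0 := fun e => hi (by linear_combination 2 * e)
      have e₄ : i ≠ h := fun e => hi (by linear_combination 2 * e + H.add_self)
      have e₅ : -i ≠ h - i := fun e => H.ne_zero (by linear_combination -e)
      have e₆ : -i ≠ h := fun e => hi (by linear_combination -2 * e - H.add_self)
      have e₇ : h - i ≠ 0 := fun e => e₄ (by linear_combination -e)
      simp [e₁, e₂, e₃, e₄, e₅, e₆, e₇, H.ne_zero.symm]
    simp_rw [sum_ite_eq_of_iff_notMem {i, -i, h - i, 0, h}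
      (fun j : R => i ≠ j ∧ i + i ≠ 0 ∧ j + j ≠ 0 ∧ i + j ≠ 0 ∧ i + j ≠ h) (fun j => by
        have e₁ : i + j = 0 ↔ j = -i := by
          constructor <;> intro e <;> linear_combination e
        have e₂ : i + j = h ↔ j = h - i := by
          constructor <;> intro e <;> linear_combination e
        have e₃ : j + j = 0 ↔ j = 0 ∨ j = h := by
          refine ⟨H.eq_or_eq j, ?_⟩
          rintro (rfl | rfl)
          exacts [add_zero 0, H.add_self]
        simp only [Finset.mem_insert, Finset.mem_singleton, ne_eq, e₁, e₂, e₃, eq_comm (a := i)]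
        tauto)]
    rw [hT, mul_one, Finset.sum_const, Finset.card_univ, smul_eq_mul, mul_comm]
  · simp [not_not.mp hi]

theorem count_mstd_a_xa_xa (H : IsLoneInvolution h) :
    (∑ i : R, ∑ j : R, ∑ k : R,
      if j ≠ k ∧ i + i ≠ 0 ∧ k ≠ j + i + i ∧ k ≠ j - i - i ∧ k ≠ h + j + i + i ∧
        k ≠ h + j - i - i then 1 else 0) =
      (Fintype.card R - 2) * ((Fintype.card R - 5) * Fintype.card R) := by
  rw [← H.sum_ite_add_self_ne_zero]
  refine Finset.sum_congr rfl fun i _ => ?_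
  split_ifs with hi
  · have hT (j : R) :
        ({j, j + i + i, j - i - i, h + j + i + i, h + j - i - i} : Finset R).card = 5 := by
      have e₁ : j ≠ j + i + i := fun e => hi (by linear_combination -e)
      have e₂ : j ≠ j - i - i := fun e => hi (by linear_combination e)
      have e₃ : j ≠ h + j + i + i := fun e =>
        H.add_self_ne i (by linear_combination -e - H.add_self)
      have e₄ : j ≠ h + j - i - i := fun e => H.add_self_ne i (by linear_combination e)
      have e₅ : j + i + i ≠ j - i - i := fun e =>
        hi (H.add_self_eq_zero_of_four (by linear_combination e))
      have e₆ : j + i + i ≠ h + j + i + i := fun e => H.ne_zero (by linear_combination -e)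
      have e₇ : j + i + i ≠ h + j - i - i := fun e =>
        H.add_self_ne (i + i) (by linear_combination e)
      have e₈ : j - i - i ≠ h + j + i + i := fun e =>
        H.add_self_ne (i + i) (by linear_combination -e - H.add_self)
      have e₉ : j - i - i ≠ h + j - i - i := fun e => H.ne_zero (by linear_combination -e)
      have e₁₀ : h + j + i + i ≠ h + j - i - i := fun e =>
        hi (H.add_self_eq_zero_of_four (by linear_combination e))
      simp only [Finset.card_insert_eq_ite, Finset.card_singleton, Finset.mem_insert,
        Finset.mem_singleton, e₁, e₂, e₃, e₄, e₅, e₆, e₇, e₈, e₉, e₁₀, or_self, if_false]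
    have hk (j : R) := sum_ite_eq_of_iff_notMem (c := 1)
      {j, j + i + i, j - i - i, h + j + i + i, h + j - i - i}
      (fun k : R => j ≠ k ∧ i + i ≠ 0 ∧ k ≠ j + i + i ∧ k ≠ j - i - i ∧ k ≠ h + j + i + i ∧
        k ≠ h + j - i - i) (fun k => by
        simp only [Finset.mem_insert, Finset.mem_singleton, ne_eq, eq_comm (a := j)]
        tauto)
    simp_rw [hk, hT, mul_one]
    rw [Finset.sum_const, Finset.card_univ, smul_eq_mul, mul_comm]
  · simp [not_not.mp hi]

theorem count_mdts_a_a_xa (H : IsLoneInvolution h) :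
    (∑ i : R, ∑ j : R, ∑ _k : R, if i ≠ j ∧ i + j = 0 then 1 else 0) =
      (Fintype.card R - 2) * Fintype.card R := by
  rw [← H.sum_ite_add_self_ne_zero]
  refine Finset.sum_congr rfl fun i _ => ?_
  rw [Finset.sum_comm]
  split_ifs with hi
  · simp_rw [sum_ite_eq_of_iff_mem {-i} (fun j : R => i ≠ j ∧ i + j = 0) (fun j => by
      rw [Finset.mem_singleton, eq_neg_iff_add_eq_zero, add_comm j, and_iff_right_iff_imp]
      rintro e rfl
      exact hi e)]
    simp
  · refine Finset.sum_eq_zero fun k _ => Finset.sum_eq_zero fun j _ => if_neg ?_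
    rintro ⟨hij, e⟩
    exact hij (by linear_combination not_not.mp hi - e)

theorem count_mdts_a_xa_xa (H : IsLoneInvolution h) :
    (∑ i : R, ∑ j : R, ∑ k : R, if j ≠ k ∧ i + i = 0 ∧ k ≠ h + j then 1 else 0) =
      2 * ((Fintype.card R - 2) * Fintype.card R) := by
  rw [← H.sum_ite_add_self_eq_zero]
  refine Finset.sum_congr rfl fun i _ => ?_
  split_ifs with hi
  · have hk (j : R) := sum_ite_eq_of_iff_notMem (c := 1) {j, h + j}
      (fun k : R => j ≠ k ∧ i + i = 0 ∧ k ≠ h + j)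
      (fun k => by
        simp only [Finset.mem_insert, Finset.mem_singleton, ne_eq, hi, eq_comm (a := j)]
        tauto)
    have hT (j : R) : ({j, h + j} : Finset R).card = 2 :=
      Finset.card_pair (by simpa using H.ne_zero)
    simp_rw [hk, hT, mul_one]
    rw [Finset.sum_const, Finset.card_univ, smul_eq_mul, mul_comm]
  · simp [hi]

theorem count_midpoint (H : IsLoneInvolution h) :
    (∑ i : R, ∑ j : R, ∑ k : R, if (i ≠ j ∧ i ≠ k ∧ j ≠ k) ∧ j + k = i + i then 1 else 0) =
      (Fintype.card R - 2) * Fintype.card R := by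
  have hj (i : R) : (∑ j : R, ∑ k : R,
      if (i ≠ j ∧ i ≠ k ∧ j ≠ k) ∧ j + k = i + i then 1 else 0) = Fintype.card R - 2 := by
    have hT : ({i, i + h} : Finset R).card = 2 := Finset.card_pair (by simpa using H.ne_zero)
    rw [← mul_one (Fintype.card R - 2), ← hT, ← sum_ite_eq_of_iff_notMem _ _ fun j => Iff.rfl]
    refine Finset.sum_congr rfl fun j _ => ?_
    simp only [Finset.mem_insert, Finset.mem_singleton, not_or]
    split_ifs with hc
    · rw [sum_ite_eq_of_iff_mem {i + i - j}, Finset.card_singleton, mul_one]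
      intro k
      rw [Finset.mem_singleton]
      constructor
      · rintro ⟨-, e⟩
        linear_combination e
      · rintro rfl
        refine ⟨⟨Ne.symm hc.1, fun e => hc.1 (by linear_combination e), fun e => hc.2 ?_⟩, by ring⟩
        exact (H.add_self_eq_add_self_iff (Ne.symm hc.1)).mp (by linear_combination -e)
    · refine Finset.sum_eq_zero fun k _ => if_neg ?_
      rintro ⟨⟨hij, hik, hjk⟩, e⟩
      refine hc ⟨hij.symm, fun e' => hjk ?_⟩
      linear_combination 2 * e' - e + H.add_self
  simp_rw [hj]
  rw [Finset.sum_const, Finset.card_univ, smul_eq_mul, mul_comm]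

theorem count_mdts_a_a_a (H : IsLoneInvolution h) (h_three : ∀ x : R, x + x + x = 0 → x = 0) :
    (∑ i : R, ∑ j : R, ∑ k : R, if (i ≠ j ∧ i ≠ k ∧ j ≠ k) ∧
      j + k ≠ i + i ∧ i + k ≠ j + j ∧ i + j ≠ k + k then 1 else 0) +
      3 * ((Fintype.card R - 2) * Fintype.card R) =
      Fintype.card R * ((Fintype.card R - 1) * (Fintype.card R - 2)) := by
  have c₁ := H.count_midpoint
  have c₂ : (∑ i : R, ∑ j : R, ∑ k : R,
      if (i ≠ j ∧ i ≠ k ∧ j ≠ k) ∧ i + k = j + j then 1 else 0) =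
      (Fintype.card R - 2) * Fintype.card R := by
    rw [← c₁, Finset.sum_comm]
    simp only [ne_comm, ne_eq, and_comm, and_assoc]
  have c₃ : (∑ i : R, ∑ j : R, ∑ k : R,
      if (i ≠ j ∧ i ≠ k ∧ j ≠ k) ∧ i + j = k + k then 1 else 0) =
      (Fintype.card R - 2) * Fintype.card R := by
    rw [← c₂]
    refine Finset.sum_congr rfl fun i _ => ?_
    rw [Finset.sum_comm]
    refine Finset.sum_congr rfl fun j _ => Finset.sum_congr rfl fun k _ => if_congr ?_ rfl rfl
    rw [ne_comm (a := k), and_left_comm]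
  rw [← sum_ite_pairwise_ne]
  rw [show ∀ m : ℕ, 3 * m = m + m + m by intro m; ring]
  nth_rewrite 1 [← c₁]
  nth_rewrite 1 [← c₂]
  nth_rewrite 1 [← c₃]
  simp_rw [← Finset.sum_add_distrib]
  refine Finset.sum_congr rfl fun i _ => Finset.sum_congr rfl fun j _ =>
    Finset.sum_congr rfl fun k _ => ?_
  by_cases hd : i ≠ j ∧ i ≠ k ∧ j ≠ k
  · have e₁₂ : j + k = i + i → i + k ≠ j + j := fun e e' =>
      hd.1 (sub_eq_zero.mp (h_three _ (by linear_combination e' - e)))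
    have e₁₃ : j + k = i + i → i + j ≠ k + k := fun e e' =>
      hd.2.1 (sub_eq_zero.mp (h_three _ (by linear_combination e' - e)))
    have e₂₃ : i + k = j + j → i + j ≠ k + k := fun e e' =>
      hd.2.2 (sub_eq_zero.mp (h_three _ (by linear_combination e' - e)))
    by_cases p : j + k = i + i
    · simp [hd, p, e₁₂ p, e₁₃ p]
    by_cases q : i + k = j + j
    · simp [hd, p, q, e₂₃ q]
    by_cases r : i + j = k + k <;> simp [hd, p, q, r]
  · simp only [hd, false_and, if_false, add_zero]

end IsLoneInvolution

end LoneInvolution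

namespace QuaternionGroup

section ZModFacts

variable {n : ℕ}

theorem natCast_add_self : (n : ZMod (2 * n)) + n = 0 := by
  have := ZMod.natCast_self (2 * n)
  push_cast at this
  rw [← this]; ring

theorem natCast_self_ne_zero [NeZero n] : (n : ZMod (2 * n)) ≠ 0 := by
  rw [Ne, ZMod.natCast_eq_zero_iff]
  intro h
  have := Nat.le_of_dvd (NeZero.pos n) h
  have := NeZero.pos n
  omega

theorem add_self_eq_zero_iff [NeZero n] (x : ZMod (2 * n)) :
    x + x = 0 ↔ x = 0 ∨ x = n := by
  constructor
  · intro h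
    obtain ⟨v, hv, rfl⟩ : ∃ v : ℕ, v < 2 * n ∧ (v : ZMod (2 * n)) = x :=
      ⟨x.val, ZMod.val_lt x, ZMod.natCast_zmod_val x⟩
    rw [← Nat.cast_add, ZMod.natCast_eq_zero_iff, ← two_mul] at h
    obtain ⟨c, rfl⟩ := Nat.dvd_of_mul_dvd_mul_left two_pos h
    have hc : c < 2 := by
      by_contra! hc
      nlinarith
    interval_cases c <;> simp
  · rintro (rfl | rfl)
    · simp
    · exact natCast_add_self

theorem add_self_ne_natCast (hodd : Odd n) (x : ZMod (2 * n)) : x + x ≠ n := by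
  intro h
  have : NeZero n := ⟨by rintro rfl; simp at hodd⟩
  have h2 := congrArg (ZMod.castHom (dvd_mul_right 2 n) (ZMod 2)) h
  rw [map_add, map_natCast, CharTwo.add_self_eq_zero, eq_comm, ZMod.natCast_eq_zero_iff] at h2
  exact (Nat.not_even_iff_odd.mpr hodd) (even_iff_two_dvd.mpr h2)

theorem eq_zero_of_add_add_self [NeZero n] (hn : ¬ 3 ∣ n) {x : ZMod (2 * n)}
    (h : x + x + x = 0) : x = 0 := by
  have hcop : Nat.Coprime 3 (2 * n) := by
    rw [Nat.Prime.coprime_iff_not_dvd Nat.prime_three, Nat.Prime.dvd_mul Nat.prime_three]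
    omega
  have hu := (ZMod.isUnit_iff_coprime 3 (2 * n)).mpr hcop
  rw [← hu.mul_right_eq_zero]
  push_cast
  linear_combination h

end ZModFacts

variable {n : ℕ}

theorem a_div_a (i j : ZMod (2 * n)) : a i / a j = a (i - j) := by
  rw [div_eq_iff_eq_mul, a_mul_a, sub_add_cancel]

theorem a_div_xa (i j : ZMod (2 * n)) : a i / xa j = xa ((n : ZMod (2 * n)) + j - i) := by
  rw [div_eq_iff_eq_mul, xa_mul_xa]
  congr 1
  ring

theorem xa_div_a (i j : ZMod (2 * n)) : xa i / a j = xa (i - j) := by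
  rw [div_eq_iff_eq_mul, xa_mul_a, sub_add_cancel]

theorem xa_div_xa (i j : ZMod (2 * n)) : xa i / xa j = a (j - i) := by
  rw [div_eq_iff_eq_mul, a_mul_xa, sub_sub_cancel]

/-- The rotations and the reflections exhaust `QuaternionGroup n`. -/
def sumEquiv (n : ℕ) : ZMod (2 * n) ⊕ ZMod (2 * n) ≃ QuaternionGroup n where
  toFun := Sum.elim a xa
  invFun
    | a i => Sum.inl i
    | xa i => Sum.inr i
  left_inv := by rintro (_ | _) <;> rfl
  right_inv := by rintro (_ | _) <;> rfl

theorem sum_eq_sum_a_add_sum_xa [NeZero n] (f : QuaternionGroup n → ℕ) :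
    ∑ x, f x = ∑ i, f (a i) + ∑ i, f (xa i) := by
  rw [← (sumEquiv n).sum_comp, Fintype.sum_sum_type]
  rfl

theorem sum_sum_sum_of_symm [NeZero n]
    (F : QuaternionGroup n → QuaternionGroup n → QuaternionGroup n → ℕ)
    (h₁ : ∀ x y z, F x y z = F y x z) (h₂ : ∀ x y z, F x y z = F x z y) :
    ∑ x, ∑ y, ∑ z, F x y z =
      ∑ i, ∑ j, ∑ k, F (a i) (a j) (a k) + 3 * ∑ i, ∑ j, ∑ k, F (a i) (a j) (xa k) +
      3 * ∑ i, ∑ j, ∑ k, F (a i) (xa j) (xa k) + ∑ i, ∑ j, ∑ k, F (xa i) (xa j) (xa k) := by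
  have e₁ : ∑ i, ∑ j, ∑ k, F (a i) (xa j) (a k) = ∑ i, ∑ j, ∑ k, F (a i) (a j) (xa k) := by
    refine Finset.sum_congr rfl fun i _ => ?_
    rw [Finset.sum_comm]
    simp_rw [h₂ (a i) (xa _) (a _)]
  have e₂ : ∑ i, ∑ j, ∑ k, F (xa i) (a j) (a k) = ∑ i, ∑ j, ∑ k, F (a i) (a j) (xa k) := by
    rw [Finset.sum_comm, ← e₁]
    simp_rw [h₁ (xa _) (a _) (a _)]
  have e₃ : ∑ i, ∑ j, ∑ k, F (xa i) (a j) (xa k) = ∑ i, ∑ j, ∑ k, F (a i) (xa j) (xa k) := by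
    rw [Finset.sum_comm]
    simp_rw [h₁ (xa _) (a _) (xa _)]
  have e₄ : ∑ i, ∑ j, ∑ k, F (xa i) (xa j) (a k) = ∑ i, ∑ j, ∑ k, F (a i) (xa j) (xa k) := by
    rw [← e₃]
    refine Finset.sum_congr rfl fun i _ => ?_
    rw [Finset.sum_comm]
    simp_rw [h₂ (xa i) (xa _) (a _)]
  simp_rw [sum_eq_sum_a_add_sum_xa, Finset.sum_add_distrib]
  rw [e₁, e₂, e₃, e₄]
  ring

theorem card_eq_card_a_add_card_xa [NeZero n] (A : Finset (QuaternionGroup n)) :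
    A.card = ({i | a i ∈ A} : Finset (ZMod (2 * n))).card +
      ({i | xa i ∈ A} : Finset (ZMod (2 * n))).card := by
  have h := sum_eq_sum_a_add_sum_xa (fun x => if x ∈ A then 1 else 0)
  simp_rw [← Finset.card_filter] at h
  simpa using h

theorem card_mul_a_a_xa [NeZero n] (i j k : ZMod (2 * n)) :
    (({a i, a j, xa k} : Finset (QuaternionGroup n)) * {a i, a j, xa k}).card =
      ({i + i, j + j, i + j, (n : ZMod (2 * n))} : Finset _).card +
      ({k + i, k - i, k + j, k - j} : Finset _).card := by
  rw [card_eq_card_a_add_card_xa]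
  congr 2 <;> ext r <;> simp [Finset.mem_mul] <;> grind

theorem card_div_a_a_xa [NeZero n] (i j k : ZMod (2 * n)) :
    (({a i, a j, xa k} : Finset (QuaternionGroup n)) / {a i, a j, xa k}).card =
      ({0, i - j, j - i} : Finset (ZMod (2 * n))).card +
      ({k - i, k - j, n + k - i, n + k - j} : Finset _).card := by
  rw [card_eq_card_a_add_card_xa]
  congr 2 <;> ext r <;>
    simp [Finset.mem_div, a_div_a, a_div_xa, xa_div_a, xa_div_xa, -div_self', -a_zero] <;> grind

theorem card_mul_a_xa_xa [NeZero n] (i j k : ZMod (2 * n)) :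
    (({a i, xa j, xa k} : Finset (QuaternionGroup n)) * {a i, xa j, xa k}).card =
      ({i + i, (n : ZMod (2 * n)), n + j - k, n + k - j} : Finset _).card +
      ({j + i, j - i, k + i, k - i} : Finset _).card := by
  rw [card_eq_card_a_add_card_xa]
  congr 2 <;> ext r <;> simp [Finset.mem_mul] <;> grind

theorem card_div_a_xa_xa [NeZero n] (i j k : ZMod (2 * n)) :
    (({a i, xa j, xa k} : Finset (QuaternionGroup n)) / {a i, xa j, xa k}).card =
      ({0, j - k, k - j} : Finset (ZMod (2 * n))).card +
      ({j - i, k - i, n + j - i, n + k - i} : Finset _).card := by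
  rw [card_eq_card_a_add_card_xa]
  congr 2 <;> ext r <;>
    simp [Finset.mem_div, a_div_a, a_div_xa, xa_div_a, xa_div_xa, -div_self', -a_zero] <;> grind

theorem card_mul_eq_card_div_xa [NeZero n] (i j k : ZMod (2 * n)) :
    (({xa i, xa j, xa k} : Finset (QuaternionGroup n)) * {xa i, xa j, xa k}).card =
      (({xa i, xa j, xa k} : Finset (QuaternionGroup n)) / {xa i, xa j, xa k}).card := by
  rw [← Finset.card_singleton_mul (a (n : ZMod (2 * n)))
    (({xa i, xa j, xa k} : Finset (QuaternionGroup n)) / {xa i, xa j, xa k})]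
  congr 1
  ext (r | r) <;>
    simp [Finset.mem_mul, Finset.mem_div, xa_div_xa, or_and_right, exists_or, -div_self', -a_zero]
  all_goals grind

theorem isLoneInvolution_natCast [NeZero n] (hodd : Odd n) :
    IsLoneInvolution (n : ZMod (2 * n)) where
  add_self := natCast_add_self
  ne_zero := natCast_self_ne_zero
  eq_or_eq x := (add_self_eq_zero_iff x).mp
  add_self_ne := add_self_ne_natCast hodd

theorem card_mul_a_a_a [NeZero n] (i j k : ZMod (2 * n)) :
    (({a i, a j, a k} : Finset (QuaternionGroup n)) * {a i, a j, a k}).card =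
      ({i + i, j + j, k + k, i + j, i + k, j + k} : Finset _).card := by
  have h : ({x | xa x ∈ ({a i, a j, a k} : Finset (QuaternionGroup n)) * {a i, a j, a k}} :
      Finset (ZMod (2 * n))) = ∅ := by
    ext r; simp [Finset.mem_mul]
  rw [card_eq_card_a_add_card_xa, h, Finset.card_empty, add_zero]
  congr 1; ext r; simp [Finset.mem_mul]; grind

theorem card_div_a_a_a [NeZero n] (i j k : ZMod (2 * n)) :
    (({a i, a j, a k} : Finset (QuaternionGroup n)) / {a i, a j, a k}).card =
      ({0, i - j, j - i, i - k, k - i, j - k, k - j} : Finset (ZMod (2 * n))).card := by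
  have h : ({x | xa x ∈ ({a i, a j, a k} : Finset (QuaternionGroup n)) / {a i, a j, a k}} :
      Finset (ZMod (2 * n))) = ∅ := by
    ext r; simp [Finset.mem_div, a_div_a, -div_self', -a_zero]
  rw [card_eq_card_a_add_card_xa, h, Finset.card_empty, add_zero]
  congr 1; ext r; simp [Finset.mem_div, a_div_a, -div_self', -a_zero]; grind

theorem compare_a_a_a [NeZero n] (hodd : Odd n) {i j k : ZMod (2 * n)} (hij : i ≠ j)
    (hik : i ≠ k) (hjk : j ≠ k) :
    ¬ IsMSTD ({a i, a j, a k} : Finset (QuaternionGroup n)) ∧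
    (IsMDTS ({a i, a j, a k} : Finset (QuaternionGroup n)) ↔
      j + k ≠ i + i ∧ i + k ≠ j + j ∧ i + j ≠ k + k) := by
  rw [IsMSTD, IsMDTS]
  have key (i j k : ZMod (2 * n)) (h : j + k = i + i) :
      (({a i, a j, a k} : Finset (QuaternionGroup n)) * {a i, a j, a k}).card =
        (({a i, a j, a k} : Finset (QuaternionGroup n)) / {a i, a j, a k}).card := by
    rw [card_mul_a_a_a, card_div_a_a_a]
    exact IsLoneInvolution.card_sum_eq_card_diff i j k h
  by_cases p : j + k = i + i
  · simp [key i j k p, p]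
  by_cases q : i + k = j + j
  · rw [Finset.insert_comm]
    simp [key j i k q, q]
  by_cases r : i + j = k + k
  · rw [Finset.pair_comm, Finset.insert_comm]
    simp [key k i j r, r]
  have := (isLoneInvolution_natCast hodd).card_sum_lt_card_diff hij hik hjk p q r
  rw [← card_mul_a_a_a, ← card_div_a_a_a] at this
  exact ⟨this.not_gt, iff_of_true this ⟨p, q, r⟩⟩

theorem six_mul_ncard [NeZero n] (P : Finset (QuaternionGroup n) → Prop) [DecidablePred P] :
    6 * {A : Finset (QuaternionGroup n) | A.card = 3 ∧ P A}.ncard =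
      (∑ i, ∑ j, ∑ k, if (i ≠ j ∧ i ≠ k ∧ j ≠ k) ∧ P {a i, a j, a k} then 1 else 0) +
      3 * (∑ i, ∑ j, ∑ k, if i ≠ j ∧ P {a i, a j, xa k} then 1 else 0) +
      3 * (∑ i, ∑ j, ∑ k, if j ≠ k ∧ P {a i, xa j, xa k} then 1 else 0) +
      ∑ i, ∑ j, ∑ k, if (i ≠ j ∧ i ≠ k ∧ j ≠ k) ∧ P {xa i, xa j, xa k} then 1 else 0 := by
  rw [six_mul_ncard_card_eq_three, sum_sum_sum_of_symm]
  · simp only [ne_eq, a.injEq, xa.injEq, reduceCtorEq, not_false_eq_true, and_true, true_and]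
  · intro x y z
    rw [Finset.insert_comm]
    refine if_congr ?_ rfl rfl
    rw [ne_comm (a := x) (b := y), and_comm (a := x ≠ z)]
  · intro x y z
    rw [Finset.pair_comm]
    refine if_congr ?_ rfl rfl
    rw [ne_comm (a := y) (b := z), and_left_comm]

theorem six_mul_ncard_isMSTD [NeZero n] (hodd : Odd n) :
    6 * {A : Finset (QuaternionGroup n) | A.card = 3 ∧ IsMSTD A}.ncard =
      6 * ((2 * n - 2) * ((2 * n - 5) * (2 * n))) := by
  classical
  have H := isLoneInvolution_natCast hodd
  rw [six_mul_ncard]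
  have h₀ (i j k : ZMod (2 * n)) : ((i ≠ j ∧ i ≠ k ∧ j ≠ k) ∧
      IsMSTD ({a i, a j, a k} : Finset (QuaternionGroup n))) ↔ False :=
    iff_false_intro fun ⟨⟨h₁, h₂, h₃⟩, h⟩ => (compare_a_a_a hodd h₁ h₂ h₃).1 h
  have h₁ (i j k : ZMod (2 * n)) : (i ≠ j ∧
      IsMSTD ({a i, a j, xa k} : Finset (QuaternionGroup n))) ↔
      i ≠ j ∧ i + i ≠ 0 ∧ j + j ≠ 0 ∧ i + j ≠ 0 ∧ i + j ≠ n :=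
    and_congr_right fun h => by
      rw [IsMSTD, card_mul_a_a_xa, card_div_a_a_xa, (H.compare_a_a_xa k h).1]
  have h₂ (i j k : ZMod (2 * n)) : (j ≠ k ∧
      IsMSTD ({a i, xa j, xa k} : Finset (QuaternionGroup n))) ↔
      j ≠ k ∧ i + i ≠ 0 ∧ k ≠ j + i + i ∧ k ≠ j - i - i ∧ k ≠ n + j + i + i ∧ k ≠ n + j - i - i :=
    and_congr_right fun h => by
      rw [IsMSTD, card_mul_a_xa_xa, card_div_a_xa_xa, (H.compare_a_xa_xa i h).1]
  have h₃ (i j k : ZMod (2 * n)) : IsMSTD ({xa i, xa j, xa k} : Finset (QuaternionGroup n)) ↔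
      False := by
    rw [IsMSTD, card_mul_eq_card_div_xa, lt_self_iff_false]
  simp_rw [h₀, h₁, h₂, h₃]
  rw [H.count_mstd_a_a_xa, H.count_mstd_a_xa_xa, ZMod.card]
  simp only [and_false, if_false, Finset.sum_const_zero]
  ring

theorem six_mul_ncard_isMDTS [NeZero n] (hodd : Odd n) (hn : ¬ 3 ∣ n) :
    6 * {A : Finset (QuaternionGroup n) | A.card = 3 ∧ IsMDTS A}.ncard +
        3 * ((2 * n - 2) * (2 * n)) =
      2 * n * ((2 * n - 1) * (2 * n - 2)) + 9 * ((2 * n - 2) * (2 * n)) := by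
  classical
  have H := isLoneInvolution_natCast hodd
  have hcount := H.count_mdts_a_a_a fun x => eq_zero_of_add_add_self hn
  rw [ZMod.card] at hcount
  rw [six_mul_ncard, ← hcount]
  have h₀ (i j k : ZMod (2 * n)) : ((i ≠ j ∧ i ≠ k ∧ j ≠ k) ∧
      IsMDTS ({a i, a j, a k} : Finset (QuaternionGroup n))) ↔
      (i ≠ j ∧ i ≠ k ∧ j ≠ k) ∧ j + k ≠ i + i ∧ i + k ≠ j + j ∧ i + j ≠ k + k :=
    and_congr_right fun ⟨h₁, h₂, h₃⟩ => (compare_a_a_a hodd h₁ h₂ h₃).2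
  have h₁ (i j k : ZMod (2 * n)) : (i ≠ j ∧
      IsMDTS ({a i, a j, xa k} : Finset (QuaternionGroup n))) ↔ i ≠ j ∧ i + j = 0 :=
    and_congr_right fun h => by
      rw [IsMDTS, card_mul_a_a_xa, card_div_a_a_xa, (H.compare_a_a_xa k h).2]
  have h₂ (i j k : ZMod (2 * n)) : (j ≠ k ∧
      IsMDTS ({a i, xa j, xa k} : Finset (QuaternionGroup n))) ↔
      j ≠ k ∧ i + i = 0 ∧ k ≠ n + j :=
    and_congr_right fun h => by
      rw [IsMDTS, card_mul_a_xa_xa, card_div_a_xa_xa, (H.compare_a_xa_xa i h).2]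
  have h₃ (i j k : ZMod (2 * n)) : IsMDTS ({xa i, xa j, xa k} : Finset (QuaternionGroup n)) ↔
      False := by
    rw [IsMDTS, card_mul_eq_card_div_xa, lt_self_iff_false]
  simp_rw [h₀, h₁, h₂, h₃]
  rw [H.count_mdts_a_a_xa, H.count_mdts_a_xa_xa, ZMod.card]
  simp only [and_false, if_false, Finset.sum_const_zero]
  ring

theorem ncard_isMSTD_add_ncard_isMDTS_add_ncard_isBalanced {G : Type*} [Group G] [Fintype G]
    [DecidableEq G] (k : ℕ) :
    {A : Finset G | A.card = k ∧ IsMSTD A}.ncard + {A : Finset G | A.card = k ∧ IsMDTS A}.ncard +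
      {A : Finset G | A.card = k ∧ IsBalanced A}.ncard = (Fintype.card G).choose k := by
  classical
  rw [← Set.ncard_union_eq, ← Set.ncard_union_eq, ← Finset.card_univ, ← Finset.card_powersetCard,
    ← Set.ncard_coe_finset]
  · congr 1
    ext A
    simp only [Set.mem_union, Set.mem_ofPred_eq, IsMSTD, IsMDTS, IsBalanced, Finset.mem_coe,
      Finset.mem_powersetCard, Finset.subset_univ, true_and]
    omega
  all_goals
    rw [Set.disjoint_left]
    rintro A
    simp only [Set.mem_union, Set.mem_ofPred_eq, IsMSTD, IsMDTS, IsBalanced]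
    omega

end QuaternionGroup

theorem stmt_3 (n : ℕ) (hn : 3 ≤ n) (hodd : Odd n) (hndvd : ¬ 3 ∣ n) :
    {A : Finset (QuaternionGroup n) | A.card = 3 ∧ IsMSTD A}.ncard
        = 4 * n * (n - 1) * (2 * n - 5) ∧
    {A : Finset (QuaternionGroup n) | A.card = 3 ∧ IsMDTS A}.ncard
        = 2 * n * (n - 1) * (2 * n + 5) / 3 ∧
    {A : Finset (QuaternionGroup n) | A.card = 3 ∧ IsBalanced A}.ncard
        = 2 * n * (2 * n ^ 2 + 27 * n - 23) / 3 := by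
  have : NeZero n := ⟨by omega⟩
  have hS := QuaternionGroup.six_mul_ncard_isMSTD hodd
  have hD := QuaternionGroup.six_mul_ncard_isMDTS hodd hndvd
  have hB := QuaternionGroup.ncard_isMSTD_add_ncard_isMDTS_add_ncard_isBalanced
    (G := QuaternionGroup n) 3
  have hC := Nat.descFactorial_eq_factorial_mul_choose (4 * n) 3
  rw [QuaternionGroup.card] at hB
  rw [← hB] at hC
  generalize {A : Finset (QuaternionGroup n) | A.card = 3 ∧ IsMSTD A}.ncard = s at *
  generalize {A : Finset (QuaternionGroup n) | A.card = 3 ∧ IsMDTS A}.ncard = d at *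
  generalize {A : Finset (QuaternionGroup n) | A.card = 3 ∧ IsBalanced A}.ncard = b at *
  clear hB this
  obtain ⟨m, rfl⟩ := Nat.exists_eq_add_of_le' hn
  simp only [Nat.descFactorial, Nat.factorial, Nat.sub_zero, mul_one] at hC
  norm_num only at hC
  rw [show 2 * (m + 3) - 2 = 2 * m + 4 by omega] at hS hD
  rw [show 2 * (m + 3) - 5 = 2 * m + 1 by omega] at hS ⊢
  rw [show 2 * (m + 3) - 1 = 2 * m + 5 by omega] at hD
  rw [show 4 * (m + 3) - 2 = 4 * m + 10 by omega, show 4 * (m + 3) - 1 = 4 * m + 11 by omega] at hC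
  rw [show m + 3 - 1 = m + 2 by omega,
    show 2 * (m + 3) ^ 2 + 27 * (m + 3) - 23 = 2 * m ^ 2 + 39 * m + 76 by
      rw [Nat.sub_eq_iff_eq_add (by nlinarith)]; ring]
  refine ⟨by linarith, ?_, ?_⟩
  · exact (Nat.div_eq_of_eq_mul_left three_pos (by linarith)).symm
  · exact (Nat.div_eq_of_eq_mul_left three_pos (by linarith)).symm
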